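/- For any g-connection ∇ on W and any n ≥ 1, the n-th wedge power R_∇^n ∈ C^{2n}(g, End_A(W)) of the curvature satisfies d^{2n}(R_∇^n) = 0. -/

import Mathlib

open scoped TensorProduct BigOperators

structure LieRinehart (k A g : Type*) [CommRing k] [CommRing A] [Algebra k A]
    [LieRing g] [LieAlgebra k g] [Module A g] [IsScalarTower k A g] where
  anchor : g → Module.End k A
  anchor_add : ∀ x y : g, anchor (x + y) = anchor x + anchor y
  anchor_smul : ∀ (a : A) (x : g) (b : A), anchor (a • x) b = a * anchor x b
  anchor_leibniz : ∀ (x : g) (a b : A), anchor x (a * b) = a * anchor x b + anchor x a * b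
  anchor_bracket : ∀ x y : g, anchor ⁅x, y⁆ = ⁅anchor x, anchor y⁆
  bracket_smul : ∀ (a : A) (x y : g), ⁅x, a • y⁆ = a • ⁅x, y⁆ + anchor x a • y

variable {k A g : Type*} [CommRing k] [CommRing A] [Algebra k A]
  [LieRing g] [LieAlgebra k g] [Module A g] [IsScalarTower k A g]

structure LRConnection (L : LieRinehart k A g) (W : Type*) [AddCommGroup W]
    [Module k W] [Module A W] [IsScalarTower k A W] where
  conn : g → Module.End k W
  conn_add : ∀ x y : g, conn (x + y) = conn x + conn y
  conn_smul : ∀ (a : A) (x : g) (w : W), conn (a • x) w = a • conn x w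
  leibniz : ∀ (x : g) (a : A) (w : W), conn x (a • w) = a • conn x w + L.anchor x a • w

variable {L : LieRinehart k A g}
variable {W W' : Type*} [AddCommGroup W] [Module k W] [Module A W] [IsScalarTower k A W]
  [AddCommGroup W'] [Module k W'] [Module A W'] [IsScalarTower k A W']

/-- The curvature of a connection, as a `k`-linear endomorphism. -/
def curvK (D : LRConnection L W) (x y : g) : Module.End k W :=
  ⁅D.conn x, D.conn y⁆ - D.conn ⁅x, y⁆

/-- Remove the entries at positions `i < j` from a tuple. -/
def remove2 {n : ℕ} (v : Fin (n + 2) → g) (i j : Fin (n + 2)) (h : i < j) : Fin n → g :=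
  fun m =>
    v (i.succAbove ((j.pred (by rintro rfl; exact absurd h (by simp))).succAbove m))

/-- The Lie–Rinehart (Chevalley–Eilenberg style) differential on cochains with values in a
module with connection. -/
noncomputable def lrD (D : LRConnection L W) {p : ℕ}
    (ψ : (Fin (p + 1) → g) → W) : (Fin (p + 2) → g) → W := fun v =>
  (∑ i : Fin (p + 2), ((-1 : ℤ) ^ (i : ℕ)) • D.conn (v i) (ψ fun m => v (i.succAbove m)))
    + ∑ i : Fin (p + 2), ∑ j : Fin (p + 2),
        if h : i < j then
          ((-1 : ℤ) ^ ((i : ℕ) + (j : ℕ))) • ψ (Fin.cons ⁅v i, v j⁆ (remove2 v i j h))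
        else 0

/-- The canonical connection on `A` itself, given by the anchor map. -/
def anchorConnection (L : LieRinehart k A g) : LRConnection L A where
  conn := L.anchor
  conn_add := L.anchor_add
  conn_smul := fun a x w => by rw [L.anchor_smul, smul_eq_mul]
  leibniz := fun x a w => by
    simp only [smul_eq_mul]; rw [L.anchor_leibniz]

/-- The induced action `ad∇` of a connection on `End_A(W)`. -/
noncomputable def adAct (D : LRConnection L W) (x : g) (φ : W →ₗ[A] W) : W →ₗ[A] W where
  toFun w := D.conn x (φ w) - φ (D.conn x w)
  map_add' u v := by simp only [map_add]; abel
  map_smul' a w := by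
    simp only [map_smul, RingHom.id_apply, D.leibniz, map_add, smul_sub]
    abel

/-- The Lie–Rinehart differential on `End_A(W)`-valued cochains, using `ad∇`. -/
noncomputable def lrDEnd (D : LRConnection L W) {p : ℕ}
    (ψ : (Fin (p + 1) → g) → (W →ₗ[A] W)) : (Fin (p + 2) → g) → (W →ₗ[A] W) := fun v =>
  (∑ i : Fin (p + 2), ((-1 : ℤ) ^ (i : ℕ)) • adAct D (v i) (ψ fun m => v (i.succAbove m)))
    + ∑ i : Fin (p + 2), ∑ j : Fin (p + 2),
        if h : i < j then
          ((-1 : ℤ) ^ ((i : ℕ) + (j : ℕ))) • ψ (Fin.cons ⁅v i, v j⁆ (remove2 v i j h))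
        else 0

/-- `σ` is a `(p,q)`-shuffle: strictly increasing on the first `p` and the last `q` positions. -/
def IsShuffle (p q : ℕ) (σ : Equiv.Perm (Fin (p + q))) : Prop :=
  (∀ i j : Fin (p + q), i < j → (j : ℕ) < p → σ i < σ j) ∧
    (∀ i j : Fin (p + q), i < j → p ≤ (i : ℕ) → σ i < σ j)

open Classical in
/-- The exterior (shuffle) product of cochains, combined with a product `f` on values. -/
noncomputable def wedge {α β γ : Type*} [AddCommGroup γ] {p q : ℕ}
    (x : (Fin p → g) → α) (y : (Fin q → g) → β) (f : α → β → γ) :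
    (Fin (p + q) → g) → γ := fun v =>
  ∑ σ : Equiv.Perm (Fin (p + q)),
    if IsShuffle p q σ then
      ((Equiv.Perm.sign σ : ℤ)) •
        f (x fun i => v (σ (Fin.castAdd q i))) (y fun i => v (σ (Fin.natAdd p i)))
    else 0

/-- Wedge powers of an `End_A(W)`-valued `2`-cochain (e.g. the curvature); `powC R n = R^n`. -/
noncomputable def powC (R : (Fin 2 → g) → (W →ₗ[A] W)) :
    (n : ℕ) → (Fin (2 * n) → g) → (W →ₗ[A] W)
  | 0 => fun _ => LinearMap.id
  | n + 1 => wedge (powC R n) R fun f1 f2 => f1 ∘ₗ f2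

/-- Reindexing a tuple along an equality of lengths. -/
def recast {n m : ℕ} (h : n = m) (v : Fin m → g) : Fin n → g := fun i => v (Fin.cast h i)

namespace ListCochain

variable {X M : Type*} [Ring M]

/-- Contraction of an inhomogeneous cochain with `x`. -/
def contract (x : X) (ψ : List X → M) : List X → M := fun l => ψ (x :: l)

/-- The grading involution, acting by `(-1) ^ n` in degree `n`. -/
def parity (ψ : List X → M) : List X → M := fun l => (-1 : ℤ) ^ l.length • ψ l

/-- The wedge product of inhomogeneous cochains, characterised by contraction being an
antiderivation. -/
def mul : (List X → M) → (List X → M) → List X → M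
  | ψ, φ, [] => ψ [] * φ []
  | ψ, φ, x :: l => mul (contract x ψ) φ l + mul (parity ψ) (contract x φ) l

/-- The Lie derivative, characterised by `[L_x, ι_y] = ι_[x,y]`. -/
def lieDer [Bracket X X] (act : X → M →+ M) (x : X) : (List X → M) → List X → M
  | ψ, [] => act x (ψ [])
  | ψ, y :: l => lieDer act x (contract y ψ) l - ψ (⁅x, y⁆ :: l)

/-- The differential, characterised by Cartan's formula `ι_x d = L_x - d ι_x`. -/
def diff [Bracket X X] (act : X → M →+ M) : (List X → M) → List X → M
  | _, [] => 0
  | ψ, x :: l => lieDer act x ψ l - diff act (contract x ψ) l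

/-- A cochain concentrated in degree `p`. -/
def Supported (p : ℕ) (ψ : List X → M) : Prop := ∀ l, l.length ≠ p → ψ l = 0

/-- Every iterated contraction of the cochain is antisymmetric in its first two arguments. -/
def Skew (ψ : List X → M) : Prop :=
  ∀ l x y m, ψ (l ++ x :: y :: m) = -ψ (l ++ y :: x :: m)

section contract

variable (x y : X) (ψ φ : List X → M)

lemma contract_add : contract x (ψ + φ) = contract x ψ + contract x φ := rfl

lemma contract_zero : contract x (0 : List X → M) = 0 := rfl

lemma contract_parity : contract x (parity ψ) = -parity (contract x ψ) := by
  funext l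
  simp [contract, parity, pow_succ]

lemma parity_add : parity (ψ + φ) = parity ψ + parity φ := by
  funext l
  simp [parity]

lemma parity_parity : parity (parity ψ) = ψ := by
  funext l
  simp only [parity, smul_smul, ← mul_pow]
  simp

lemma contract_mul :
    contract x (mul ψ φ) = mul (contract x ψ) φ + mul (parity ψ) (contract x φ) := rfl

lemma contract_lieDer [Bracket X X] (act : X → M →+ M) :
    contract y (lieDer act x ψ) = lieDer act x (contract y ψ) - contract ⁅x, y⁆ ψ := rfl

lemma contract_diff [Bracket X X] (act : X → M →+ M) :
    contract x (diff act ψ) = lieDer act x ψ - diff act (contract x ψ) := rfl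

end contract

lemma mul_nil (ψ φ : List X → M) : mul ψ φ [] = ψ [] * φ [] := by rw [mul]

lemma mul_cons (ψ φ : List X → M) (x : X) (l : List X) :
    mul ψ φ (x :: l) = mul (contract x ψ) φ l + mul (parity ψ) (contract x φ) l := by
  rw [mul]

lemma add_mul (ψ₁ ψ₂ φ : List X → M) : mul (ψ₁ + ψ₂) φ = mul ψ₁ φ + mul ψ₂ φ := by
  funext l
  induction l generalizing ψ₁ ψ₂ φ with
  | nil => simp [mul_nil, _root_.add_mul]
  | cons x l ih =>
    simp only [mul_cons, contract_add, parity_add, ih, Pi.add_apply]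
    abel

lemma mul_add (ψ φ₁ φ₂ : List X → M) : mul ψ (φ₁ + φ₂) = mul ψ φ₁ + mul ψ φ₂ := by
  funext l
  induction l generalizing ψ φ₁ φ₂ with
  | nil => simp [mul_nil, _root_.mul_add]
  | cons x l ih =>
    simp only [mul_cons, contract_add, ih, Pi.add_apply]
    abel

lemma zero_mul (φ : List X → M) : mul 0 φ = 0 := by
  simpa using add_mul 0 0 φ

lemma mul_zero (ψ : List X → M) : mul ψ 0 = 0 := by
  simpa using mul_add ψ 0 0

lemma neg_mul (ψ φ : List X → M) : mul (-ψ) φ = -mul ψ φ :=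
  eq_neg_of_add_eq_zero_left (by rw [← add_mul, neg_add_cancel, zero_mul])

lemma mul_neg (ψ φ : List X → M) : mul ψ (-φ) = -mul ψ φ :=
  eq_neg_of_add_eq_zero_left (by rw [← mul_add, neg_add_cancel, mul_zero])

lemma zsmul_mul (n : ℤ) (ψ φ : List X → M) : mul (n • ψ) φ = n • mul ψ φ :=
  map_zsmul (AddMonoidHom.mk' (fun χ => mul χ φ) fun _ _ => add_mul _ _ _) n ψ

section differential

variable [Bracket X X] (act : X → M →+ M)

lemma lieDer_add (x : X) (ψ φ : List X → M) :
    lieDer act x (ψ + φ) = lieDer act x ψ + lieDer act x φ := by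
  funext l
  induction l generalizing ψ φ with
  | nil => simp [lieDer]
  | cons y l ih =>
    simp only [lieDer, contract_add, ih, Pi.add_apply]
    abel

lemma lieDer_zero (x : X) : lieDer act x (0 : List X → M) = 0 := by
  simpa using lieDer_add act x 0 0

lemma lieDer_neg (x : X) (ψ : List X → M) : lieDer act x (-ψ) = -lieDer act x ψ :=
  eq_neg_of_add_eq_zero_left (by rw [← lieDer_add, neg_add_cancel, lieDer_zero])

lemma lieDer_parity (x : X) (ψ : List X → M) :
    lieDer act x (parity ψ) = parity (lieDer act x ψ) := by
  funext l
  induction l generalizing ψ with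
  | nil => simp [lieDer, parity]
  | cons y l ih =>
    simp only [lieDer, contract_parity, lieDer_neg, Pi.neg_apply, ih, parity, List.length_cons,
      pow_succ, smul_sub]
    simp

lemma diff_add (ψ φ : List X → M) : diff act (ψ + φ) = diff act ψ + diff act φ := by
  funext l
  induction l generalizing ψ φ with
  | nil => simp [diff]
  | cons y l ih =>
    simp only [diff, contract_add, lieDer_add, ih, Pi.add_apply]
    abel

lemma diff_zero : diff act (0 : List X → M) = 0 := by
  simpa using diff_add act 0 0

lemma diff_neg (ψ : List X → M) : diff act (-ψ) = -diff act ψ :=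
  eq_neg_of_add_eq_zero_left (by rw [← diff_add, neg_add_cancel, diff_zero])

lemma diff_parity (ψ : List X → M) : diff act (parity ψ) = -parity (diff act ψ) := by
  funext l
  induction l generalizing ψ with
  | nil => simp [diff, parity]
  | cons y l ih =>
    simp only [diff, contract_parity, diff_neg, lieDer_parity, Pi.neg_apply, ih, parity,
      List.length_cons, pow_succ, smul_sub]
    simp
    abel

variable {act} (hact : ∀ x a b, act x (a * b) = act x a * b + a * act x b)
include hact

lemma lieDer_mul (x : X) (ψ φ : List X → M) :
    lieDer act x (mul ψ φ) = mul (lieDer act x ψ) φ + mul ψ (lieDer act x φ) := by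
  funext l
  induction l generalizing ψ φ with
  | nil => simp [lieDer, mul_nil, hact]
  | cons y l ih =>
    simp only [lieDer, contract_mul, lieDer_add, Pi.add_apply, ih, mul_cons, contract_lieDer,
      sub_eq_add_neg, add_mul, mul_add, neg_mul, mul_neg, Pi.neg_apply, lieDer_parity]
    abel

lemma diff_mul (ψ φ : List X → M) :
    diff act (mul ψ φ) = mul (diff act ψ) φ + mul (parity ψ) (diff act φ) := by
  funext l
  induction l generalizing ψ φ with
  | nil => simp [diff, mul_nil]
  | cons x l ih =>
    simp only [diff, contract_mul, diff_add, lieDer_mul hact, Pi.add_apply, ih, mul_cons,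
      contract_diff, sub_eq_add_neg, add_mul, mul_add, neg_mul, mul_neg, Pi.neg_apply,
      contract_parity, parity_parity, diff_parity]
    abel

end differential

lemma Skew.contract {ψ : List X → M} (h : Skew ψ) (x : X) : Skew (contract x ψ) :=
  fun l => h (x :: l)

lemma Skew.swap {ψ : List X → M} (h : Skew ψ) (x y : X) (l : List X) :
    ψ (x :: y :: l) = -ψ (y :: x :: l) :=
  h [] x y l

lemma Skew.parity {ψ : List X → M} (h : Skew ψ) : Skew (parity ψ) := fun l x y m => by
  simp [ListCochain.parity, h l x y m]

lemma Skew.mul {ψ φ : List X → M} (hψ : Skew ψ) (hφ : Skew φ) : Skew (mul ψ φ) := by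
  intro l x y m
  induction l generalizing ψ φ with
  | nil =>
    have key (χ : List X → M) (hχ : Skew χ) :
        ListCochain.contract y (ListCochain.contract x χ) =
          -ListCochain.contract x (ListCochain.contract y χ) := funext fun l => hχ.swap x y l
    simp only [List.nil_append, mul_cons, contract_parity, key ψ hψ, key φ hφ, neg_mul, mul_neg,
      Pi.neg_apply]
    abel
  | cons z l ih =>
    simp only [List.cons_append, mul_cons, ih (hψ.contract z) hφ, ih hψ.parity (hφ.contract z)]
    abel

/-- Increasing on the positions below `p` and on the positions from `p` on. -/
def IsShuffleAt (p : ℕ) {N : ℕ} (σ : Equiv.Perm (Fin N)) : Prop :=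
  ∀ i j : Fin N, i < j → ((j : ℕ) < p ∨ p ≤ (i : ℕ)) → σ i < σ j

/-- The permutation sending `k` to `0` that is given by `τ` on the other positions. -/
def insertPerm {N : ℕ} (k : Fin (N + 1)) (τ : Equiv.Perm (Fin N)) : Equiv.Perm (Fin (N + 1)) :=
  Equiv.Perm.decomposeFin.symm (0, τ) * k.cycleRange

section insertPerm

variable {N : ℕ} (k : Fin (N + 1)) (τ : Equiv.Perm (Fin N))

lemma insertPerm_self : insertPerm k τ k = 0 := by
  simp [insertPerm]

lemma insertPerm_succAbove (i : Fin N) : insertPerm k τ (k.succAbove i) = (τ i).succ := by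
  simp [insertPerm]

lemma sign_insertPerm :
    ((Equiv.Perm.sign (insertPerm k τ) : ℤˣ) : ℤ) = (-1) ^ (k : ℕ) * Equiv.Perm.sign τ := by
  simp [insertPerm, Fin.sign_cycleRange, mul_comm]

lemma insertPerm_bijective :
    Function.Bijective fun x : Fin (N + 1) × Equiv.Perm (Fin N) => insertPerm x.1 x.2 := by
  rw [Fintype.bijective_iff_injective_and_card]
  refine ⟨?_, by simp [Fintype.card_perm, Nat.factorial_succ]⟩
  rintro ⟨k, τ⟩ ⟨k', τ'⟩ h
  dsimp only at h
  obtain rfl : k = k' := by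
    apply (insertPerm k τ).injective
    rw [insertPerm_self, h, insertPerm_self]
  rw [Prod.mk.injEq]
  refine ⟨rfl, Equiv.ext fun i => ?_⟩
  rw [← Fin.succ_inj, ← insertPerm_succAbove k, h, insertPerm_succAbove]

lemma sum_perm_succ (F : Equiv.Perm (Fin (N + 1)) → M) :
    ∑ σ, F σ = ∑ k, ∑ τ, F (insertPerm k τ) := by
  rw [← Fintype.sum_prod_type']
  exact (Fintype.sum_bijective _ insertPerm_bijective _ _ fun _ => rfl).symm

variable {k τ}

lemma isShuffleAt_insertPerm_of_eq {p : ℕ} (hk : (k : ℕ) = p) :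
    IsShuffleAt p (insertPerm k τ) ↔ IsShuffleAt p τ := by
  subst hk
  constructor
  · intro h i j hij hp
    rw [← Fin.succ_lt_succ_iff, ← insertPerm_succAbove k, ← insertPerm_succAbove k]
    refine h _ _ (by simpa using hij) ?_
    rcases hp with hp | hp
    · left
      rw [Fin.succAbove_of_castSucc_lt _ _ (by simpa [Fin.lt_def] using hp)]
      simpa using hp
    · right
      rw [Fin.succAbove_of_le_castSucc _ _ (by simpa [Fin.le_def] using hp)]
      simp; omega
  · intro h i j hij hp
    induction j using Fin.succAboveCases k with
    | x =>
      rcases hp with hp | hp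
      · exact absurd hp (lt_irrefl _)
      · exact absurd hij (not_lt.2 hp)
    | p j =>
      induction i using Fin.succAboveCases k with
      | x => simp [insertPerm_self, insertPerm_succAbove]
      | p i =>
        rw [insertPerm_succAbove, insertPerm_succAbove, Fin.succ_lt_succ_iff]
        refine h _ _ (by simpa using hij) ?_
        rcases hp with hp | hp
        · left
          by_contra hc
          rw [Fin.succAbove_of_le_castSucc _ _ (by simpa [Fin.le_def] using hc)] at hp
          simp at hp; omega
        · right
          by_contra hc
          rw [Fin.succAbove_of_castSucc_lt _ _ (by simpa [Fin.lt_def] using hc)] at hp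
          simp at hp; omega

lemma isShuffleAt_insertPerm_zero {p : ℕ} :
    IsShuffleAt (p + 1) (insertPerm 0 τ) ↔ IsShuffleAt p τ := by
  have key (i : Fin N) : insertPerm 0 τ i.succ = (τ i).succ := insertPerm_succAbove 0 τ i
  constructor
  · intro h i j hij hp
    simpa [key] using h i.succ j.succ (by simpa using hij) (by simpa using hp)
  · intro h i j hij hp
    induction j using Fin.cases with
    | zero => simp at hij
    | succ j =>
      induction i using Fin.cases with
      | zero => simp [insertPerm_self, key]
      | succ i =>
        simpa [key] using h i j (by simpa using hij) (by simpa using hp)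

lemma not_isShuffleAt_insertPerm {p : ℕ} (h0 : p = 0 ∨ k ≠ 0) (hp : (k : ℕ) ≠ p) :
    ¬ IsShuffleAt p (insertPerm k τ) := by
  intro h
  rcases lt_or_gt_of_ne hp with hlt | hlt
  · have hk : k ≠ 0 := h0.resolve_left (by omega)
    have := h 0 k (Fin.pos_iff_ne_zero.2 hk) (Or.inl hlt)
    simp [insertPerm_self] at this
  · have := h ⟨p, by omega⟩ k hlt (Or.inr le_rfl)
    simp [insertPerm_self] at this

variable (k τ)

lemma ofFn_insertNth (a : X) (u : Fin N → X) :
    List.ofFn (k.insertNth a u : Fin (N + 1) → X) =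
      (List.ofFn u).take k ++ a :: (List.ofFn u).drop k := by
  apply List.ext_getElem
  · simp; omega
  · intro n h₁ h₂
    rw [List.length_ofFn] at h₁
    obtain ⟨i, rfl⟩ : ∃ i : Fin (N + 1), (i : ℕ) = n := ⟨⟨n, h₁⟩, rfl⟩
    rw [List.getElem_ofFn, Fin.eta, List.getElem_append]
    induction i using Fin.succAboveCases k with
    | x =>
      have hk : (k : ℕ) - min (k : ℕ) N = 0 := by omega
      simp [hk]
    | p i =>
      rcases lt_or_ge (i : ℕ) k with hi | hi
      · have : ((k.succAbove i : Fin (N + 1)) : ℕ) = i := by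
          rw [Fin.succAbove_of_castSucc_lt _ _ (by simpa [Fin.lt_def] using hi)]; simp
        simp [this, hi]
      · have : ((k.succAbove i : Fin (N + 1)) : ℕ) = i + 1 := by
          rw [Fin.succAbove_of_le_castSucc _ _ (by simpa [Fin.le_def] using hi)]; simp
        have hik : (i : ℕ) + 1 - min (k : ℕ) N = (i - k) + 1 := by omega
        have hki : (k : ℕ) + (i - k) = i := by omega
        simp [this, hik, hki, show ¬ ((i : ℕ) + 1 < k) by omega]

lemma ofFn_comp_insertPerm (u : Fin (N + 1) → X) :
    List.ofFn (u ∘ insertPerm k τ) = (List.ofFn (Fin.tail u ∘ τ)).take k ++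
      u 0 :: (List.ofFn (Fin.tail u ∘ τ)).drop k := by
  rw [← ofFn_insertNth]
  congr 1
  funext i
  induction i using Fin.succAboveCases k with
  | x => simp [insertPerm_self]
  | p i => simp [insertPerm_succAbove, Fin.tail]

end insertPerm

open Classical in
/-- The shuffle sum over permutations of `Fin N` splitting a tuple at position `p`. -/
noncomputable def shuffleSum (p : ℕ) {N : ℕ} (ψ φ : List X → M) (u : Fin N → X) : M :=
  ∑ σ : Equiv.Perm (Fin N), if IsShuffleAt p σ then
    (Equiv.Perm.sign σ : ℤ) •
      (ψ ((List.ofFn (u ∘ σ)).take p) * φ ((List.ofFn (u ∘ σ)).drop p)) else 0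

lemma Supported.contract_zero {ψ : List X → M} (h : Supported 0 ψ) (x : X) :
    contract x ψ = 0 :=
  funext fun _ => h _ (by simp)

lemma Supported.contract_succ {p : ℕ} {ψ : List X → M} (h : Supported (p + 1) ψ) (x : X) :
    Supported p (contract x ψ) :=
  fun l hl => h _ (by simpa using hl)

lemma Supported.parity_eq {p : ℕ} {ψ : List X → M} (h : Supported p ψ) :
    parity ψ = (-1 : ℤ) ^ p • ψ := by
  funext l
  by_cases hl : l.length = p
  · simp [parity, hl]
  · simp [parity, h l hl]

lemma Supported.mul {p q : ℕ} {ψ φ : List X → M} (hψ : Supported p ψ) (hφ : Supported q φ) :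
    Supported (p + q) (mul ψ φ) := by
  intro l
  induction l generalizing p q ψ φ with
  | nil =>
    intro hl
    rw [mul_nil]
    rcases Nat.eq_zero_or_pos p with rfl | hp
    · rw [hφ [] (by simpa using hl), MulZeroClass.mul_zero]
    · rw [hψ [] (by simpa using hp.ne), MulZeroClass.zero_mul]
  | cons x l ih =>
    intro hl
    have h₁ : ListCochain.mul (contract x ψ) φ l = 0 := by
      cases p with
      | zero => rw [hψ.contract_zero, zero_mul, Pi.zero_apply]
      | succ p => exact ih (hψ.contract_succ x) hφ (by simp at hl; omega)
    have h₂ : ListCochain.mul (parity ψ) (contract x φ) l = 0 := by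
      rw [hψ.parity_eq, zsmul_mul, Pi.smul_apply]
      cases q with
      | zero => rw [hφ.contract_zero, mul_zero, Pi.zero_apply, smul_zero]
      | succ q => rw [ih hψ (hφ.contract_succ x) (by simp at hl; omega), smul_zero]
    rw [mul_cons, h₁, h₂, add_zero]

section shuffleSum

variable (ψ φ : List X → M) {p N : ℕ} (u : Fin (N + 1) → X)

open Classical in
lemma sum_insertPerm_of_eq {k : Fin (N + 1)} (hk : (k : ℕ) = p) :
    (∑ τ : Equiv.Perm (Fin N), if IsShuffleAt p (insertPerm k τ) then
      (Equiv.Perm.sign (insertPerm k τ) : ℤ) •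
        (ψ ((List.ofFn (u ∘ insertPerm k τ)).take p) *
          φ ((List.ofFn (u ∘ insertPerm k τ)).drop p)) else 0) =
      (-1 : ℤ) ^ p • shuffleSum p ψ (contract (u 0) φ) (Fin.tail u) := by
  rw [shuffleSum, Finset.smul_sum]
  refine Finset.sum_congr rfl fun τ _ => ?_
  subst hk
  have hlen : ((List.ofFn (Fin.tail u ∘ τ)).take k).length = k := by simp; omega
  simp only [isShuffleAt_insertPerm_of_eq rfl, sign_insertPerm, ofFn_comp_insertPerm,
    List.take_left' hlen, List.drop_left' hlen, smul_ite, smul_zero, mul_smul]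
  rfl

open Classical in
lemma sum_insertPerm_zero :
    (∑ τ : Equiv.Perm (Fin N), if IsShuffleAt (p + 1) (insertPerm 0 τ) then
      (Equiv.Perm.sign (insertPerm 0 τ) : ℤ) •
        (ψ ((List.ofFn (u ∘ insertPerm 0 τ)).take (p + 1)) *
          φ ((List.ofFn (u ∘ insertPerm 0 τ)).drop (p + 1))) else 0) =
      shuffleSum p (contract (u 0) ψ) φ (Fin.tail u) := by
  rw [shuffleSum]
  refine Finset.sum_congr rfl fun τ _ => ?_
  simp only [isShuffleAt_insertPerm_zero, sign_insertPerm, ofFn_comp_insertPerm, contract]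
  simp

variable {ψ}

lemma shuffleSum_eq_zero (hψ : Supported p ψ) (hp : N + 1 < p + 1) (u : Fin N → X) :
    shuffleSum p ψ φ u = 0 := by
  refine Finset.sum_eq_zero fun σ _ => ?_
  rw [hψ _ (by simp; omega), MulZeroClass.zero_mul, smul_zero, ite_self]

lemma shuffleSum_succ (hψ : Supported p ψ) :
    shuffleSum p ψ φ u = shuffleSum (p - 1) (contract (u 0) ψ) φ (Fin.tail u) +
      (-1 : ℤ) ^ p • shuffleSum p ψ (contract (u 0) φ) (Fin.tail u) := by
  classical
  rw [shuffleSum, sum_perm_succ]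
  cases p with
  | zero =>
    rw [Fintype.sum_eq_single 0, sum_insertPerm_of_eq _ _ _ (p := 0) rfl, hψ.contract_zero]
    · simp [shuffleSum]
    · exact fun k hk => Finset.sum_eq_zero fun τ _ =>
        if_neg (not_isShuffleAt_insertPerm (Or.inl rfl) fun h => hk (Fin.ext h))
  | succ p =>
    rw [Nat.add_sub_cancel]
    rcases lt_or_ge p N with hp | hp
    · rw [Fintype.sum_eq_add 0 ⟨p + 1, by omega⟩, sum_insertPerm_zero,
        sum_insertPerm_of_eq _ _ _ (p := p + 1) rfl]
      · simp [Fin.ext_iff]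
      · exact fun k hk => Finset.sum_eq_zero fun τ _ =>
          if_neg (not_isShuffleAt_insertPerm (Or.inr hk.1) (by simpa [Fin.ext_iff] using hk.2))
    · rw [Fintype.sum_eq_single 0, sum_insertPerm_zero,
        shuffleSum_eq_zero _ hψ (by omega), smul_zero, add_zero]
      exact fun k hk => Finset.sum_eq_zero fun τ _ =>
        if_neg (not_isShuffleAt_insertPerm (Or.inr hk) (by omega))

end shuffleSum

lemma shuffleSum_eq_mul {p N : ℕ} {ψ : List X → M} (hψ : Supported p ψ) (φ : List X → M)
    (u : Fin N → X) : shuffleSum p ψ φ u = mul ψ φ (List.ofFn u) := by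
  induction N generalizing p ψ φ with
  | zero => simp [shuffleSum, IsShuffleAt, mul_nil]
  | succ N ih =>
    rw [shuffleSum_succ _ _ hψ, List.ofFn_succ, mul_cons, hψ.parity_eq, zsmul_mul, Pi.smul_apply,
      ih hψ]
    congr 1
    cases p with
    | zero => simp [hψ.contract_zero, zero_mul, shuffleSum]
    | succ p => exact ih (hψ.contract_succ _) _ _

open Classical in
lemma wedge_eq_mul {p q : ℕ} {ψ : List X → M} (hψ : Supported p ψ) (φ : List X → M)
    (u : Fin (p + q) → X) :
    wedge (fun a : Fin p → X => ψ (List.ofFn a)) (fun b : Fin q → X => φ (List.ofFn b))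
      (fun a b => a * b) u = mul ψ φ (List.ofFn u) := by
  rw [← shuffleSum_eq_mul hψ]
  refine Finset.sum_congr rfl fun σ _ => ?_
  have hshuffle : IsShuffle p q σ ↔ IsShuffleAt p σ := by
    constructor
    · rintro ⟨h₁, h₂⟩ i j hij (h | h)
      exacts [h₁ i j hij h, h₂ i j hij h]
    · exact fun h => ⟨fun i j hij hj => h i j hij (Or.inl hj),
        fun i j hij hi => h i j hij (Or.inr hi)⟩
  have hofFn : List.ofFn (u ∘ σ) = List.ofFn (fun i => u (σ (Fin.castAdd q i))) ++
      List.ofFn (fun i => u (σ (Fin.natAdd p i))) := by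
    rw [← List.ofFn_fin_append]
    congr 1
    exact (Fin.append_castAdd_natAdd (f := u ∘ σ)).symm
  rw [hofFn, List.take_left' List.length_ofFn, List.drop_left' List.length_ofFn]
  exact if_congr hshuffle rfl rfl

lemma ofFn_succAbove {N : ℕ} (v : Fin (N + 1) → X) (i : Fin (N + 1)) :
    List.ofFn (fun m => v (i.succAbove m)) = (List.ofFn v).eraseIdx i := by
  induction N with
  | zero => obtain rfl := Fin.fin_one_eq_zero i; simp
  | succ N ih =>
    induction i using Fin.cases with
    | zero => simp
    | succ i =>
      rw [List.ofFn_succ (f := v), List.ofFn_succ, Fin.val_succ, List.eraseIdx_cons_succ,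
        ← ih (fun m => v m.succ)]
      simp

lemma ofFn_remove2 {g : Type*} [LieRing g] {N : ℕ} (v : Fin (N + 2) → g) (i j : Fin (N + 2)) (h : i < j) :
    List.ofFn (remove2 v i j h) = ((List.ofFn v).eraseIdx i).eraseIdx (j - 1) := by
  rw [← ofFn_succAbove v i]
  exact ofFn_succAbove (fun m => v (i.succAbove m)) (j.pred _)

section explicit

variable [Bracket X X] (act : X → M →+ M) {N : ℕ}

lemma lieDer_ofFn {ψ : List X → M} (hψ : Skew ψ) (x : X) (v : Fin N → X) :
    lieDer act x ψ (List.ofFn v) = act x (ψ (List.ofFn v)) +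
      ∑ j : Fin N, (-1 : ℤ) ^ (j + 1 : ℕ) • ψ (⁅x, v j⁆ :: (List.ofFn v).eraseIdx j) := by
  induction N generalizing ψ with
  | zero => simp [lieDer]
  | succ N ih =>
    rw [List.ofFn_succ, lieDer, ih (hψ.contract _), Fin.sum_univ_succ]
    simp only [contract, Fin.val_zero, Fin.val_succ, List.eraseIdx_cons_succ,
      List.eraseIdx_cons_zero]
    have (j : Fin N) := hψ.swap (v 0) ⁅x, v j.succ⁆ ((List.ofFn fun i => v i.succ).eraseIdx j)
    simp only [this, pow_succ _ (_ + 1)]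
    simp
    abel

lemma diff_ofFn {ψ : List X → M} (hψ : Skew ψ) (v : Fin N → X) :
    diff act ψ (List.ofFn v) =
      (∑ i : Fin N, (-1 : ℤ) ^ (i : ℕ) • act (v i) (ψ ((List.ofFn v).eraseIdx i))) +
      ∑ i : Fin N, ∑ j : Fin N, if i < j then (-1 : ℤ) ^ ((i : ℕ) + (j : ℕ)) •
        ψ (⁅v i, v j⁆ :: ((List.ofFn v).eraseIdx i).eraseIdx (j - 1)) else 0 := by
  induction N generalizing ψ with
  | zero => simp [diff]
  | succ N ih =>
    have hswap (i j : Fin N) (h : i < j) :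
        ψ (⁅v i.succ, v j.succ⁆ :: (v 0 :: (List.ofFn fun m => v m.succ).eraseIdx i).eraseIdx j) =
          -ψ (v 0 :: ⁅v i.succ, v j.succ⁆ ::
            ((List.ofFn fun m => v m.succ).eraseIdx i).eraseIdx (j - 1)) := by
      obtain ⟨k, hk⟩ : ∃ k, (j : ℕ) = k + 1 := ⟨j - 1, by have := Fin.lt_def.1 h; omega⟩
      rw [hk, List.eraseIdx_cons_succ, Nat.add_sub_cancel, hψ.swap]
    have hsum : ∀ i j : Fin N, (if i < j then (-1 : ℤ) ^ ((i + 1 : ℕ) + (j + 1 : ℕ)) •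
        ψ (⁅v i.succ, v j.succ⁆ :: (v 0 :: (List.ofFn fun m => v m.succ).eraseIdx i).eraseIdx j)
          else 0) = -(if i < j then (-1 : ℤ) ^ ((i : ℕ) + (j : ℕ)) •
        ψ (v 0 :: ⁅v i.succ, v j.succ⁆ ::
          ((List.ofFn fun m => v m.succ).eraseIdx i).eraseIdx (j - 1)) else 0) := by
      intro i j
      split_ifs with h
      · rw [hswap i j h, smul_neg, add_add_add_comm, pow_add _ _ (1 + 1)]
        simp
      · simp
    rw [List.ofFn_succ, diff, ih (hψ.contract _), lieDer_ofFn act hψ]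
    simp only [Fin.sum_univ_succ, contract, Fin.val_zero, Fin.val_succ, List.eraseIdx_cons_succ,
      List.eraseIdx_cons_zero, Fin.succ_lt_succ_iff, Fin.succ_pos, Fin.not_lt_zero, if_true,
      if_false, Nat.add_sub_cancel, hsum, zero_add, Finset.sum_neg_distrib, pow_succ]
    simp
    abel

end explicit

/-- The unit of `mul`: the identity in degree `0`. -/
def one : List X → M
  | [] => 1
  | _ :: _ => 0

/-- The cochain concentrated in degree `2` with values `r`. -/
def ofTwo (r : X → X → M) : List X → M
  | [x, y] => r x y
  | _ => 0

/-- The powers of a cochain for `mul`. -/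
def pow (ρ : List X → M) : ℕ → List X → M
  | 0 => one
  | n + 1 => mul (pow ρ n) ρ

lemma supported_one : Supported 0 (one : List X → M)
  | [], h => absurd rfl h
  | _ :: _, _ => rfl

lemma skew_one : Skew (one : List X → M)
  | [], _, _, _ => neg_zero.symm
  | _ :: _, _, _, _ => neg_zero.symm

lemma supported_ofTwo (r : X → X → M) : Supported 2 (ofTwo r)
  | [], _ => rfl
  | [_], _ => rfl
  | [_, _], h => absurd rfl h
  | _ :: _ :: _ :: _, _ => rfl

lemma skew_ofTwo {r : X → X → M} (hr : ∀ x y, r x y = -r y x) : Skew (ofTwo r)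
  | [], x, y, [] => hr x y
  | [], _, _, _ :: _ => neg_zero.symm
  | [_], _, _, _ => neg_zero.symm
  | _ :: _ :: l, _, _, _ => by cases l <;> simp [ofTwo]

lemma supported_pow {ρ : List X → M} (hρ : Supported 2 ρ) (n : ℕ) :
    Supported (2 * n) (pow ρ n) := by
  induction n with
  | zero => exact supported_one
  | succ n ih => exact ih.mul hρ

lemma skew_pow {ρ : List X → M} (hρ : Skew ρ) (n : ℕ) : Skew (pow ρ n) := by
  induction n with
  | zero => exact skew_one
  | succ n ih => exact ih.mul hρ

section pow

variable [Bracket X X] {act : X → M →+ M}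

lemma diff_ofTwo {r : X → X → M}
    (hr : ∀ x y z, act x (r y z) - r ⁅x, y⁆ z - r y ⁅x, z⁆ - (act y (r x z) - r x ⁅y, z⁆) +
      act z (r x y) = 0) : diff act (ofTwo r) = 0 := by
  have h₁ (x : X) : contract x (fun _ => 0 : List X → M) = 0 := rfl
  have h₂ (x y z : X) : contract z (contract y (contract x (ofTwo r))) = 0 := rfl
  funext l
  match l with
  | [] => simp [diff]
  | [x] => simp [diff, lieDer, ofTwo]
  | [x, y] => simp [diff, lieDer, ofTwo, contract]
  | [x, y, z] =>
    rw [Pi.zero_apply, ← hr x y z]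
    simp only [diff, lieDer, ofTwo, contract]
    abel
  | x :: y :: z :: t :: l =>
    simp only [diff, lieDer, h₂, lieDer_zero, diff_zero, contract_zero]
    simp [ofTwo, contract]

variable (hact : ∀ x a b, act x (a * b) = act x a * b + a * act x b)
include hact

lemma diff_one : diff act (one : List X → M) = 0 := by
  have h1 (x : X) : act x 1 = 0 := by simpa using hact x 1 1
  have hc (x : X) : contract x (one : List X → M) = 0 := rfl
  funext l
  match l with
  | [] => simp [diff]
  | [x] => simp [diff, lieDer, one, h1]
  | x :: y :: l => simp [diff, lieDer, hc, lieDer_zero, contract_zero, diff_zero, one]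

lemma diff_pow {ρ : List X → M} (hρ : diff act ρ = 0) (n : ℕ) : diff act (pow ρ n) = 0 := by
  induction n with
  | zero => exact diff_one hact
  | succ n ih => rw [pow, diff_mul hact, ih, hρ, zero_mul, mul_zero, add_zero]

end pow

end ListCochain

open ListCochain

/-- The action `ad∇` as an additive endomorphism of `End_A(W)`. -/
noncomputable def adActHom (D : LRConnection L W) (x : g) :
    Module.End A W →+ Module.End A W where
  toFun := adAct D x
  map_zero' := by ext; simp [adAct]
  map_add' φ χ := by ext; simp [adAct]; abel

lemma adAct_mul (D : LRConnection L W) (x : g) (φ χ : Module.End A W) :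
    adAct D x (φ * χ) = adAct D x φ * χ + φ * adAct D x χ := by
  ext; simp [adAct]

lemma lrDEnd_eq_diff (D : LRConnection L W) {p : ℕ} {ψ : List g → Module.End A W} (hψ : Skew ψ)
    (v : Fin (p + 2) → g) :
    lrDEnd D (fun u : Fin (p + 1) → g => ψ (List.ofFn u)) v =
      diff (adActHom D) ψ (List.ofFn v) := by
  rw [diff_ofFn _ hψ, lrDEnd]
  congr 1
  · simp only [ofFn_succAbove]
    rfl
  · refine Finset.sum_congr rfl fun i _ => Finset.sum_congr rfl fun j _ => ?_
    split_ifs with h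
    · rw [List.ofFn_cons, ofFn_remove2]
    · rfl

lemma powC_eq_pow {X : Type*} (r : X → X → Module.End A W) (n : ℕ) :
    powC (fun u => r (u 0) (u 1)) n = fun u => pow (ofTwo r) n (List.ofFn u) := by
  induction n with
  | zero => funext u; simp [powC, pow, one]; rfl
  | succ n ih =>
    funext u
    rw [powC, ih, pow, ← wedge_eq_mul (supported_pow (supported_ofTwo r) n)]
    rfl

/-- for all `n ≥ 1`, `d(R_∇^n) = 0`. -/
theorem lrD_curvature_pow (D : LRConnection L W) (R : (Fin 2 → g) → (W →ₗ[A] W))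
    (hR : ∀ (u : Fin 2 → g) (w : W), R u w = curvK D (u 0) (u 1) w)
    (n : ℕ) (v : Fin (2 * n + 3) → g) :
    lrDEnd D (powC R (n + 1)) v = 0 := by
  let r : g → g → Module.End A W := fun x y => R ![x, y]
  have hr (x y : g) (w : W) : r x y w = curvK D x y w := hR _ w
  have hRr : R = fun u => r (u 0) (u 1) := by
    ext u w
    rw [hR, hr]
  have hskew : Skew (ofTwo r) := skew_ofTwo fun x y => by
    ext w
    have hneg : D.conn (-⁅x, y⁆) = -D.conn ⁅x, y⁆ :=
      (AddMonoidHom.mk' D.conn D.conn_add).map_neg _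
    simp only [LinearMap.neg_apply, hr, curvK, ← lie_skew y x, hneg, Ring.lie_def,
      LinearMap.sub_apply, Module.End.mul_apply]
    abel
  have hdiff : diff (adActHom D) (ofTwo r) = 0 := diff_ofTwo fun x y z => by
    ext w
    have hjacobi : D.conn ⁅x, ⁅y, z⁆⁆ = D.conn ⁅⁅x, y⁆, z⁆ + D.conn ⁅y, ⁅x, z⁆⁆ := by
      rw [leibniz_lie, D.conn_add]
    simp only [adActHom, adAct, AddMonoidHom.coe_mk, ZeroHom.coe_mk, LinearMap.add_apply,
      LinearMap.sub_apply, LinearMap.zero_apply, LinearMap.coe_mk, AddHom.coe_mk, hr, curvK,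
      hjacobi, Ring.lie_def, Module.End.mul_apply, map_sub]
    abel
  rw [hRr, powC_eq_pow]
  exact (lrDEnd_eq_diff D (skew_pow hskew _) v).trans
    (congrFun (diff_pow (adAct_mul D) hdiff _) _)
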